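/- Let B₁,…,B_m ∈ Sⁿ, set J₋ = ⋂_{ℓ=1}^m J₋(B_ℓ), and assume J₀(B_k) ⊆ J₋ for every k = 1,…,m. For Q, H ∈ Sⁿ, define the SDP value ζ_p(J₋,Q,H) = inf{⟨Q,X⟩ : X ∈ J₋, ⟨H,X⟩ = 1} and the QCQP value ζ_p(K∩J₋,Q,H) = inf{xᵀQx : x ∈ ℝⁿ, xᵀB_k x ≤ 0 for k = 1,…,m, xᵀHx = 1}, both in [−∞,+∞] with inf over the empty set equal to +∞. Then −∞ < ζ_p(J₋,Q,H) = ζ_p(K∩J₋,Q,H) < +∞ if and only if −∞ < ζ_p(J₋,Q,H) < +∞. -/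

import Mathlib

open Matrix

/-- `J₋ = ⋂_ℓ J₋(B_ℓ) = {X ∈ Sⁿ₊ : ⟨B_ℓ, X⟩ ≤ 0 for all ℓ}`,
with inner product `⟨B, X⟩ = trace (B X)`. -/
def Jminus {n m : ℕ} (B : Fin m → Matrix (Fin n) (Fin n) ℝ) :
    Set (Matrix (Fin n) (Fin n) ℝ) :=
  {X | X.PosSemidef ∧ ∀ l, ((B l) * X).trace ≤ 0}

/-- `J₀(B) = {X ∈ Sⁿ₊ : ⟨B, X⟩ = 0}`. -/
def J0 {n : ℕ} (B : Matrix (Fin n) (Fin n) ℝ) : Set (Matrix (Fin n) (Fin n) ℝ) :=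
  {X | X.PosSemidef ∧ (B * X).trace = 0}

/-- The SDP optimal value `ζ_p(J₋, Q, H) = inf {⟨Q, X⟩ : X ∈ J₋, ⟨H, X⟩ = 1}` in
`[-∞, +∞]`, equal to `+∞` when infeasible. -/
noncomputable def zetaSDP {n : ℕ} (Q H : Matrix (Fin n) (Fin n) ℝ)
    (C : Set (Matrix (Fin n) (Fin n) ℝ)) : EReal :=
  sInf ((fun X => (((Q * X).trace : ℝ) : EReal)) '' {X | X ∈ C ∧ (H * X).trace = 1})

/-- The QCQP optimal value
`ζ_p(K ∩ J₋, Q, H) = inf {xᵀQx : xᵀB_k x ≤ 0 (∀ k), xᵀHx = 1}` in `[-∞, +∞]`,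
equal to `+∞` when infeasible. -/
noncomputable def zetaQCQP {n m : ℕ} (Q H : Matrix (Fin n) (Fin n) ℝ)
    (B : Fin m → Matrix (Fin n) (Fin n) ℝ) : EReal :=
  sInf ((fun x : Fin n → ℝ => ((x ⬝ᵥ Q.mulVec x : ℝ) : EReal)) ''
    {x | (∀ k, x ⬝ᵥ (B k).mulVec x ≤ 0) ∧ x ⬝ᵥ H.mulVec x = 1})

/-- A real matrix of negative trace takes a negative value on some vector of signs: the average
of its quadratic form over all sign vectors is its trace. -/
theorem exists_sign_dotProduct_mulVec_neg {n : ℕ} (N : Matrix (Fin n) (Fin n) ℝ)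
    (hN : N.trace < 0) :
    ∃ e : Fin n → ℝ, (∀ i, e i * e i = 1) ∧ e ⬝ᵥ N.mulVec e < 0 := by
  have off : ∀ i j : Fin n, i ≠ j →
      ∑ s : Fin n → ℤˣ, ((s i : ℤ) : ℝ) * ((s j : ℤ) : ℝ) = 0 := by
    intro i j hij
    have hflip : Function.Involutive (fun s : Fin n → ℤˣ => Function.update s i (-s i)) := by
      intro s
      simp
    have key := Equiv.sum_comp hflip.toPerm
      (fun s : Fin n → ℤˣ => ((s i : ℤ) : ℝ) * ((s j : ℤ) : ℝ))
    simp only [Function.Involutive.coe_toPerm, Function.update_self,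
      Function.update_of_ne hij.symm, Units.val_neg, Int.cast_neg, neg_mul,
      Finset.sum_neg_distrib] at key
    linarith
  have sq : ∀ u : ℤˣ, ((u : ℤ) : ℝ) * ((u : ℤ) : ℝ) = 1 := by
    intro u
    rcases Int.units_eq_one_or u with rfl | rfl <;> simp
  have total : ∑ s : Fin n → ℤˣ,
      (fun i => ((s i : ℤ) : ℝ)) ⬝ᵥ N.mulVec (fun i => ((s i : ℤ) : ℝ)) =
      (Fintype.card (Fin n → ℤˣ) : ℝ) * N.trace := by
    simp only [dotProduct, mulVec, Finset.mul_sum, Matrix.trace, Matrix.diag]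
    rw [Finset.sum_comm]
    refine Finset.sum_congr rfl fun i _ => ?_
    rw [Finset.sum_comm, Finset.sum_eq_single i]
    · rw [Finset.sum_congr rfl (g := fun _ => N i i)]
      · simp
      · intro s _
        linear_combination N i i * sq (s i)
    · intro j _ hj
      rw [Finset.sum_congr rfl
        (g := fun s : Fin n → ℤˣ => N i j * (((s i : ℤ) : ℝ) * ((s j : ℤ) : ℝ))),
        ← Finset.mul_sum, off i j hj.symm, mul_zero]
      intro s _
      ring
    · simp
  have hneg : ∑ s : Fin n → ℤˣ,
      (fun i => ((s i : ℤ) : ℝ)) ⬝ᵥ N.mulVec (fun i => ((s i : ℤ) : ℝ)) < 0 := by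
    rw [total]
    exact mul_neg_of_pos_of_neg (by exact_mod_cast Fintype.card_pos) hN
  obtain ⟨s, -, hs⟩ := Finset.exists_lt_of_sum_lt (s := Finset.univ)
    (g := fun _ : Fin n → ℤˣ => (0 : ℝ)) (by simpa using hneg)
  exact ⟨_, fun i => sq (s i), hs⟩

theorem dotProduct_mulVec_mulVec_mulVec {n : ℕ} (M A : Matrix (Fin n) (Fin n) ℝ)
    (e : Fin n → ℝ) :
    A.mulVec e ⬝ᵥ M.mulVec (A.mulVec e) = e ⬝ᵥ (Aᵀ * M * A).mulVec e := by
  rw [← mulVec_mulVec, ← mulVec_mulVec, dotProduct_mulVec e, vecMul_transpose]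

open scoped MatrixOrder Matrix.Norms.L2Operator in
/-- If `Y` is positive semidefinite with `⟨B, Y⟩ = 0` and `⟨M, Y⟩ < 0`, then some rank-one matrix
`x xᵀ` has the same two properties. -/
theorem Matrix.PosSemidef.exists_dotProduct_mulVec_eq_zero_neg {n : ℕ}
    {Y B M : Matrix (Fin n) (Fin n) ℝ}
    (hY : Y.PosSemidef) (hB : B.IsSymm) (hBY : (B * Y).trace = 0) (hMY : (M * Y).trace < 0) :
    ∃ x : Fin n → ℝ, x ⬝ᵥ B.mulVec x = 0 ∧ x ⬝ᵥ M.mulVec x < 0 := by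
  obtain ⟨L, rfl⟩ : ∃ L : Matrix (Fin n) (Fin n) ℝ, Y = L * Lᵀ := by
    obtain ⟨L, hL⟩ := CStarAlgebra.nonneg_iff_eq_star_mul_self.1 hY.nonneg
    exact ⟨Lᵀ, by simpa [star_eq_conjTranspose] using hL⟩
  have hC : (Lᵀ * B * L).IsHermitian := by
    rw [IsHermitian, conjTranspose_eq_transpose_of_trivial]
    simp [hB.eq, Matrix.mul_assoc]
  obtain ⟨U, d, hU, hd⟩ : ∃ (U : Matrix (Fin n) (Fin n) ℝ) (d : Fin n → ℝ),
      U * Uᵀ = 1 ∧ Uᵀ * (Lᵀ * B * L) * U = diagonal d := by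
    refine ⟨hC.eigenvectorUnitary, hC.eigenvalues, ?_, ?_⟩
    · simpa [star_eq_conjTranspose] using Unitary.coe_mul_star_self hC.eigenvectorUnitary
    · have := hC.conjStarAlgAut_star_eigenvectorUnitary
      simpa [Unitary.conjStarAlgAut_apply, star_eq_conjTranspose, Function.comp_def] using this
  have tr : ∀ N : Matrix (Fin n) (Fin n) ℝ,
      ((L * U)ᵀ * N * (L * U)).trace = (N * (L * Lᵀ)).trace := by
    intro N
    rw [trace_mul_comm, ← Matrix.mul_assoc, trace_mul_comm N, transpose_mul]
    congr 2
    rw [Matrix.mul_assoc, ← Matrix.mul_assoc U, hU, Matrix.one_mul]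
  obtain ⟨e, he, hneg⟩ := exists_sign_dotProduct_mulVec_neg ((L * U)ᵀ * M * (L * U))
    (by rwa [tr])
  refine ⟨(L * U).mulVec e, ?_, by rwa [dotProduct_mulVec_mulVec_mulVec]⟩
  have hD : (L * U)ᵀ * B * (L * U) = diagonal d := by
    rw [← hd]
    simp [Matrix.mul_assoc]
  have ht := tr B
  rw [hD, hBY, trace_diagonal] at ht
  rw [dotProduct_mulVec_mulVec_mulVec, hD, ← ht]
  refine Finset.sum_congr rfl fun i _ => ?_
  rw [mulVec_diagonal]
  linear_combination d i * he i

theorem trace_mul_vecMulVec_self {n : ℕ} (M : Matrix (Fin n) (Fin n) ℝ) (x : Fin n → ℝ) :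
    (M * vecMulVec x x).trace = x ⬝ᵥ M.mulVec x := by
  rw [mul_vecMulVec, trace_vecMulVec, dotProduct_comm]

theorem posSemidef_vecMulVec_self_real {n : ℕ} (x : Fin n → ℝ) :
    (vecMulVec x x).PosSemidef := by
  simpa using posSemidef_vecMulVec_self_star x

theorem vecMulVec_self_mem_Jminus_iff {n m : ℕ} {B : Fin m → Matrix (Fin n) (Fin n) ℝ}
    {x : Fin n → ℝ} :
    vecMulVec x x ∈ Jminus B ↔ ∀ k, x ⬝ᵥ (B k).mulVec x ≤ 0 := by
  simp only [Jminus, Set.mem_ofPred_eq, trace_mul_vecMulVec_self]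
  exact and_iff_right (posSemidef_vecMulVec_self_real x)

theorem add_smul_mem_Jminus {n m : ℕ} {B : Fin m → Matrix (Fin n) (Fin n) ℝ}
    {X Y : Matrix (Fin n) (Fin n) ℝ} (hX : X ∈ Jminus B) (hY : Y ∈ Jminus B)
    {t : ℝ} (ht : 0 ≤ t) : X + t • Y ∈ Jminus B := by
  refine ⟨hX.1.add (hY.1.smul ht), fun l => ?_⟩
  rw [mul_add, Matrix.mul_smul, trace_add, trace_smul, smul_eq_mul]
  have := mul_nonpos_of_nonneg_of_nonpos ht (hY.2 l)
  linarith [hX.2 l]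

/-- A linear functional that is negative somewhere on `J₋` is negative at some rank-one element
of `J₋`. -/
theorem exists_vecMulVec_mem_Jminus_neg {n m : ℕ} {B : Fin m → Matrix (Fin n) (Fin n) ℝ}
    (hB : ∀ k, (B k).IsSymm) (h : ∀ k, J0 (B k) ⊆ Jminus B)
    {M X : Matrix (Fin n) (Fin n) ℝ} (hX : X ∈ Jminus B) (hM : (M * X).trace < 0) :
    ∃ x : Fin n → ℝ, vecMulVec x x ∈ Jminus B ∧ x ⬝ᵥ M.mulVec x < 0 := by
  obtain ⟨x, -, hx⟩ := hX.1.exists_dotProduct_mulVec_eq_zero_neg (B := 0)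
    (by simp [IsSymm]) (by simp) hM
  by_cases hgood : vecMulVec x x ∈ Jminus B
  · exact ⟨x, hgood, hx⟩
  rw [vecMulVec_self_mem_Jminus_iff] at hgood
  push Not at hgood
  obtain ⟨k, hk⟩ := hgood
  have hXk := hX.2 k
  have hY : (((x ⬝ᵥ (B k).mulVec x) • X +
      (-(B k * X).trace) • vecMulVec x x) : Matrix (Fin n) (Fin n) ℝ).PosSemidef :=
    (hX.1.smul hk.le).add ((posSemidef_vecMulVec_self_real x).smul (neg_nonneg.2 hXk))
  obtain ⟨y, hy0, hy⟩ := hY.exists_dotProduct_mulVec_eq_zero_neg (M := M) (hB k)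
    (by
      rw [mul_add, Matrix.mul_smul, Matrix.mul_smul, trace_add, trace_smul, trace_smul,
        trace_mul_vecMulVec_self, smul_eq_mul, smul_eq_mul]
      ring)
    (by
      rw [mul_add, Matrix.mul_smul, Matrix.mul_smul, trace_add, trace_smul, trace_smul,
        trace_mul_vecMulVec_self, smul_eq_mul, smul_eq_mul]
      nlinarith [mul_neg_of_pos_of_neg hk hM])
  exact ⟨y, h k ⟨posSemidef_vecMulVec_self_real y, by rwa [trace_mul_vecMulVec_self]⟩, hy⟩

theorem zetaSDP_le {n : ℕ} {Q H X : Matrix (Fin n) (Fin n) ℝ}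
    {C : Set (Matrix (Fin n) (Fin n) ℝ)} (hX : X ∈ C) (hHX : (H * X).trace = 1) :
    zetaSDP Q H C ≤ (((Q * X).trace : ℝ) : EReal) :=
  sInf_le ⟨X, ⟨hX, hHX⟩, rfl⟩

theorem zetaSDP_le_zetaQCQP {n m : ℕ} (B : Fin m → Matrix (Fin n) (Fin n) ℝ)
    (Q H : Matrix (Fin n) (Fin n) ℝ) : zetaSDP Q H (Jminus B) ≤ zetaQCQP Q H B := by
  refine le_sInf ?_
  rintro _ ⟨x, ⟨hx, hHx⟩, rfl⟩
  simpa only [trace_mul_vecMulVec_self] using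
    zetaSDP_le (Q := Q) (vecMulVec_self_mem_Jminus_iff.2 hx)
      ((trace_mul_vecMulVec_self H x).trans hHx)

/-- If the SDP is feasible and bounded below, the objective is nonnegative on recession
directions. -/
theorem trace_mul_nonneg_of_bot_lt_zetaSDP {n m : ℕ} {B : Fin m → Matrix (Fin n) (Fin n) ℝ}
    {Q H X Y : Matrix (Fin n) (Fin n) ℝ} (hbot : ⊥ < zetaSDP Q H (Jminus B))
    (hX : X ∈ Jminus B) (hHX : (H * X).trace = 1)
    (hY : Y ∈ Jminus B) (hHY : (H * Y).trace = 0) : 0 ≤ (Q * Y).trace := by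
  by_contra! hneg
  obtain ⟨r, -, hr⟩ := EReal.lt_iff_exists_real_btwn.1 hbot
  have hle : ∀ t : ℝ, 0 ≤ t → r < (Q * X).trace + t * (Q * Y).trace := by
    intro t ht
    have := hr.trans_le (zetaSDP_le (Q := Q) (H := H) (add_smul_mem_Jminus hX hY ht)
      (by rw [mul_add, Matrix.mul_smul, trace_add, trace_smul, hHX, hHY]; simp))
    rw [mul_add, Matrix.mul_smul, trace_add, trace_smul, smul_eq_mul] at this
    exact_mod_cast this
  have h0 := hle 0 le_rfl
  have h1 := hle (((Q * X).trace - r) / (-(Q * Y).trace))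
    (div_nonneg (by linarith) (by linarith))
  have : ((Q * X).trace - r) / (-(Q * Y).trace) * (Q * Y).trace = r - (Q * X).trace := by
    field_simp [hneg.ne]
    ring
  linarith

theorem zetaQCQP_le_of_lt_mul {n m : ℕ} {B : Fin m → Matrix (Fin n) (Fin n) ℝ}
    {Q H : Matrix (Fin n) (Fin n) ℝ} {x : Fin n → ℝ} {q : ℝ}
    (hx : ∀ k, x ⬝ᵥ (B k).mulVec x ≤ 0) (hpos : 0 < x ⬝ᵥ H.mulVec x)
    (hq : x ⬝ᵥ Q.mulVec x < q * x ⬝ᵥ H.mulVec x) : zetaQCQP Q H B ≤ (q : EReal) := by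
  set a := x ⬝ᵥ H.mulVec x
  have form : ∀ N : Matrix (Fin n) (Fin n) ℝ,
      ((√a)⁻¹ • x) ⬝ᵥ N.mulVec ((√a)⁻¹ • x) = a⁻¹ * (x ⬝ᵥ N.mulVec x) := by
    intro N
    rw [mulVec_smul, dotProduct_smul, smul_dotProduct, smul_eq_mul, smul_eq_mul, ← mul_assoc,
      ← mul_inv, Real.mul_self_sqrt hpos.le]
  unfold zetaQCQP
  refine sInf_le_of_le (Set.mem_image_of_mem _ (show (√a)⁻¹ • x ∈ _ from ⟨fun k => ?_, ?_⟩)) ?_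
  · rw [form]
    exact mul_nonpos_of_nonneg_of_nonpos (inv_nonneg.2 hpos.le) (hx k)
  · rw [form]
    exact inv_mul_cancel₀ hpos.ne'
  · simp only [form]
    rw [EReal.coe_le_coe_iff, inv_mul_le_iff₀ hpos, mul_comm]
    exact hq.le

theorem zetaQCQP_le_zetaSDP {n m : ℕ} {B : Fin m → Matrix (Fin n) (Fin n) ℝ}
    (hB : ∀ k, (B k).IsSymm) (h : ∀ k, J0 (B k) ⊆ Jminus B)
    {Q H : Matrix (Fin n) (Fin n) ℝ} (hbot : ⊥ < zetaSDP Q H (Jminus B)) :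
    zetaQCQP Q H B ≤ zetaSDP Q H (Jminus B) := by
  refine le_sInf ?_
  rintro _ ⟨X, ⟨hX, hHX⟩, rfl⟩
  refine EReal.le_of_forall_lt_iff_le.1 fun q hq => ?_
  have hq' : (Q * X).trace < q := EReal.coe_lt_coe_iff.1 hq
  obtain ⟨x, hx, hneg⟩ := exists_vecMulVec_mem_Jminus_neg hB h (M := Q - q • H) hX (by
    rw [sub_mul, smul_mul, trace_sub, trace_smul, hHX, smul_eq_mul]
    linarith)
  rw [sub_mulVec, smul_mulVec, dotProduct_sub, dotProduct_smul, smul_eq_mul] at hneg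
  rcases lt_trichotomy (x ⬝ᵥ H.mulVec x) 0 with hlt | heq | hgt
  · exfalso
    have hs : 0 < (-(x ⬝ᵥ H.mulVec x))⁻¹ := inv_pos.2 (neg_pos.2 hlt)
    have hsH : (-(x ⬝ᵥ H.mulVec x))⁻¹ * (x ⬝ᵥ H.mulVec x) = -1 := by
      field_simp [hlt.ne]
    have := trace_mul_nonneg_of_bot_lt_zetaSDP hbot hX hHX (add_smul_mem_Jminus hX hx hs.le) (by
      rw [mul_add, Matrix.mul_smul, trace_add, trace_smul, trace_mul_vecMulVec_self, smul_eq_mul, hsH,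
        hHX]
      norm_num)
    rw [mul_add, Matrix.mul_smul, trace_add, trace_smul, trace_mul_vecMulVec_self, smul_eq_mul] at this
    have hcomb := mul_neg_of_pos_of_neg hs hneg
    rw [mul_sub, mul_left_comm, hsH] at hcomb
    linarith
  · exfalso
    have := trace_mul_nonneg_of_bot_lt_zetaSDP hbot hX hHX hx
      ((trace_mul_vecMulVec_self H x).trans heq)
    rw [trace_mul_vecMulVec_self] at this
    rw [heq] at hneg
    linarith
  · exact zetaQCQP_le_of_lt_mul (vecMulVec_self_mem_Jminus_iff.1 hx) hgt (by linarith)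

/-- Theorem 4.1 (ii): under `J₀(B_k) ⊆ J₋` for all `k`, the SDP relaxation value is
finite and equal to the QCQP value iff the SDP relaxation value is finite. -/
theorem stmt_16 {n m : ℕ} (B : Fin m → Matrix (Fin n) (Fin n) ℝ)
    (hBsym : ∀ k, (B k).IsSymm)
    (h : ∀ k, J0 (B k) ⊆ Jminus B)
    (Q H : Matrix (Fin n) (Fin n) ℝ) (hQsym : Q.IsSymm) (hHsym : H.IsSymm) :
    (⊥ < zetaSDP Q H (Jminus B) ∧ zetaSDP Q H (Jminus B) = zetaQCQP Q H B ∧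
      zetaQCQP Q H B < ⊤) ↔
    (⊥ < zetaSDP Q H (Jminus B) ∧ zetaSDP Q H (Jminus B) < ⊤) := by
  constructor
  · rintro ⟨hbot, heq, htop⟩
    exact ⟨hbot, heq ▸ htop⟩
  · rintro ⟨hbot, htop⟩
    have heq := (zetaSDP_le_zetaQCQP B Q H).antisymm (zetaQCQP_le_zetaSDP hBsym h hbot)
    exact ⟨hbot, heq, heq ▸ htop⟩
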